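/- There exists a transcendental entire function f : ℂ → ℂ given on all of ℂ by a power series f(z) = Σ_{n≥0} a_n zⁿ with all coefficients a_n rational, such that f(Q̄) ⊆ Q̄ and f⁻¹(Q̄) ⊆ Q̄. -/

import Mathlib

open Polynomial

lemma mq_bdd (p : ℚ[X]) (R : ℝ) : ∃ C : ℝ, 0 < C ∧ ∀ z : ℂ, ‖z‖ ≤ R → ‖aeval z p‖ ≤ C := by
  have h := (isCompact_closedBall (0:ℂ) R).exists_bound_of_continuousOn
    (f := fun z : ℂ => aeval z p) (by fun_prop)
  obtain ⟨C, hC⟩ := h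
  refine ⟨max C 1, by positivity, fun z hz => (hC z (by simpa using hz)).trans (le_max_left _ _)⟩

lemma mq_bddC (p : ℂ[X]) (R : ℝ) : ∃ C : ℝ, 0 ≤ C ∧ ∀ z : ℂ, ‖z‖ ≤ R → ‖p.eval z‖ ≤ C := by
  have h := (isCompact_closedBall (0:ℂ) R).exists_bound_of_continuousOn
    (f := fun z : ℂ => p.eval z) (by fun_prop)
  obtain ⟨C, hC⟩ := h
  refine ⟨max C 1, by positivity, fun z hz => (hC z (by simpa using hz)).trans (le_max_left _ _)⟩

lemma mq_lip (M : ℚ[X]) (hM : M ≠ 0) (R : ℝ) : ∃ C : ℝ, 0 < C ∧ ∀ w : ℂ, ‖w‖ ≤ R →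
    ∀ α : ℂ, aeval α M = 0 → ‖aeval w M‖ ≤ C * ‖w - α‖ := by
  have key : ∀ α : ℂ, ∃ C : ℝ, 0 ≤ C ∧ (aeval α M = 0 → ∀ w : ℂ, ‖w‖ ≤ R →
      ‖aeval w M‖ ≤ C * ‖w - α‖) := by
    intro α
    by_cases h : aeval α M = 0
    · have h1 : (M.map (algebraMap ℚ ℂ)).IsRoot α := by
        simpa [IsRoot, eval_map_algebraMap] using h
      obtain ⟨q, hq⟩ := dvd_iff_isRoot.2 h1
      obtain ⟨C, hC, hb⟩ := mq_bddC q R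
      refine ⟨C, hC, fun _ w hw => ?_⟩
      rw [← eval_map_algebraMap, hq]
      simp only [eval_mul, eval_sub, eval_X, eval_C, norm_mul]
      rw [mul_comm]
      gcongr
      exact hb w hw
    · exact ⟨0, le_rfl, fun h' => absurd h' h⟩
  choose C hC0 hC using key
  let S := (M.map (algebraMap ℚ ℂ)).roots.toFinset
  refine ⟨∑ α ∈ S, C α + 1, by have := Finset.sum_nonneg (fun α (_ : α ∈ S) => hC0 α); positivity,
    fun w hw α hα => (hC α hα w hw).trans ?_⟩
  gcongr
  have hmem : α ∈ S := by
    have hM' : M.map (algebraMap ℚ ℂ) ≠ 0 :=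
      (Polynomial.map_ne_zero_iff (algebraMap ℚ ℂ).injective).2 hM
    simp only [S, Multiset.mem_toFinset, mem_roots hM', IsRoot, eval_map_algebraMap, hα]
  have := Finset.single_le_sum (fun α (_ : α ∈ S) => hC0 α) hmem
  linarith

lemma mq_step (M f : ℚ[X]) (hM : M ≠ 0) (hf : 0 < f.natDegree) (R δ : ℝ) (hδ : 0 < δ) :
    ∃ g : ℚ[X], f.natDegree < (f + g).natDegree ∧ X ^ (f.natDegree + 1) ∣ g ∧ M ∣ g ∧
      (∀ z : ℂ, ‖z‖ ≤ R → ‖aeval z g‖ ≤ δ) ∧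
      ∀ z : ℂ, ‖z‖ ≤ R → ∀ α : ℂ, aeval α M = 0 → ‖aeval z g‖ ≤ δ * ‖aeval z f - α‖ := by
  set N : ℚ[X] := X ^ (f.natDegree + 1) * M with hN
  set P : ℚ[X] := N * M.comp f with hP
  have hcomp : M.comp f ≠ 0 := by
    intro h
    rcases comp_eq_zero_iff.1 h with h | ⟨_, h⟩
    · exact hM h
    · rw [h] at hf; simp at hf
  have hN0 : N ≠ 0 := mul_ne_zero (pow_ne_zero _ X_ne_zero) hM
  have hP0 : P ≠ 0 := mul_ne_zero hN0 hcomp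
  have hdvd : X ^ (f.natDegree + 1) ∣ P := ⟨M * M.comp f, by rw [hP, hN]; ring⟩
  have hdeg : f.natDegree < P.natDegree := by
    have := natDegree_le_of_dvd hdvd hP0
    simp at this
    omega
  obtain ⟨C1, hC1, b1⟩ := mq_bdd P R
  obtain ⟨C2, hC2, b2⟩ := mq_bdd N R
  obtain ⟨C3, hC3, b3⟩ := mq_bdd f R
  obtain ⟨C4, hC4, b4⟩ := mq_lip M hM C3
  obtain ⟨ε, hε0, hε⟩ := exists_rat_btwn (show (0:ℝ) < δ / (C1 + C2 * C4) by positivity)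
  have hε0' : 0 < ε := by exact_mod_cast hε0
  rw [lt_div_iff₀ (by positivity)] at hε
  have hnorm : ∀ z : ℂ, ‖aeval z (C ε * P)‖ = ε * ‖aeval z P‖ := by
    intro z
    simp [hε0'.le]
  refine ⟨C ε * P, ?_, hdvd.mul_left _, ?_, ?_, ?_⟩
  · rw [natDegree_add_eq_right_of_natDegree_lt] <;> rwa [natDegree_C_mul hε0'.ne']
  · exact ⟨C ε * X ^ (f.natDegree + 1) * M.comp f, by rw [hP, hN]; ring⟩
  · intro z hz
    rw [hnorm]
    have := b1 z hz
    have h2 : (ε:ℝ) * ‖aeval z P‖ ≤ ε * C1 := by gcongr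
    have h3 : 0 ≤ (ε:ℝ) * (C2 * C4) := by positivity
    linarith
  · intro z hz α hα
    rw [hnorm, hP, map_mul, norm_mul, aeval_comp]
    have e1 := b2 z hz
    have e2 := b4 _ (b3 z hz) α hα
    calc (ε:ℝ) * (‖aeval z N‖ * ‖aeval (aeval z f) M‖)
        ≤ ε * (C2 * (C4 * ‖aeval z f - α‖)) := by gcongr
      _ = (ε * (C2 * C4)) * ‖aeval z f - α‖ := by ring
      _ ≤ δ * ‖aeval z f - α‖ := by
        gcongr
        have h3 : 0 ≤ (ε:ℝ) * C1 := by positivity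
        linarith

lemma mq_bddpoly (p : ℂ[X]) : ∃ C : ℝ, 0 ≤ C ∧ ∀ z : ℂ, 1 ≤ ‖z‖ → ∀ n, p.natDegree ≤ n → 
    ‖p.eval z‖ ≤ C * ‖z‖ ^ n := by
  refine ⟨∑ i ∈ Finset.range (p.natDegree + 1), ‖p.coeff i‖, by positivity, fun z hz n hn => ?_⟩
  rw [eval_eq_sum_range, Finset.sum_mul]
  refine (norm_sum_le _ _).trans (Finset.sum_le_sum fun i hi => ?_)
  rw [norm_mul, norm_pow]
  gcongr
  simp at hi; omega

lemma mq_lower (p : ℂ[X]) (hp : p ≠ 0) : ∃ c : ℝ, 0 < c ∧ ∃ R : ℝ, ∀ z : ℂ, R ≤ ‖z‖ → 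
    c ≤ ‖p.eval z‖ := by
  by_cases h : 0 < p.degree
  · have h1 : Filter.Tendsto (fun z : ℂ => ‖p.eval z‖) (Filter.comap norm Filter.atTop) Filter.atTop :=
      p.tendsto_norm_atTop h Filter.tendsto_comap
    have h2 := h1.eventually_ge_atTop 1
    rw [Filter.eventually_comap] at h2
    obtain ⟨R, hR⟩ := Filter.eventually_atTop.1 h2
    exact ⟨1, one_pos, R, fun z hz => hR _ hz z rfl⟩
  · have h1 := eq_C_of_degree_le_zero (not_lt.1 h)
    refine ⟨‖p.coeff 0‖, ?_, 0, fun z _ => ?_⟩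
    · rw [norm_pos_iff]
      intro h0; rw [h0] at h1; simp at h1; exact hp h1
    · rw [h1]; simp

lemma mq_growth (Q : ℂ[X][X]) (hQ : Q ≠ 0) (F : ℂ → ℂ) (h : ∀ z, (Q.eval (C (F z))).eval z = 0) :
    ∃ C : ℝ, 0 ≤ C ∧ ∃ N : ℕ, ∃ R : ℝ, ∀ z, R ≤ ‖z‖ → ‖F z‖ ≤ C * ‖z‖ ^ N := by
  obtain ⟨c, hc, R, hR⟩ := mq_lower Q.leadingCoeff (leadingCoeff_ne_zero.2 hQ)
  choose K hK0 hK using mq_bddpoly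
  set d := Q.natDegree with hd
  let N := ∑ j ∈ Finset.range d, (Q.coeff j).natDegree
  let S := ∑ j ∈ Finset.range d, K (Q.coeff j)
  have hS : 0 ≤ S := Finset.sum_nonneg fun j _ => hK0 _
  refine ⟨1 + S / c, by positivity, N, max R 1, fun z hz => ?_⟩
  have hz1 : 1 ≤ ‖z‖ := (le_max_right _ _).trans hz
  have hzR := hR z ((le_max_left _ _).trans hz)
  have hzN : 1 ≤ ‖z‖ ^ N := one_le_pow₀ hz1
  rcases le_total ‖F z‖ 1 with hF | hF
  · have : 0 ≤ S / c := by positivity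
    nlinarith
  have h0 := h z
  rw [eval_eq_sum_range (p := Q), eval_finsetSum] at h0
  simp only [eval_mul, eval_pow, eval_C] at h0
  rw [Finset.sum_range_succ, ← hd] at h0
  have h1 : ‖eval z (Q.coeff d)‖ * ‖F z‖ ^ d ≤ 
      ∑ j ∈ Finset.range d, ‖eval z (Q.coeff j)‖ * ‖F z‖ ^ j := by
    rw [← norm_pow, ← norm_mul, eq_neg_of_add_eq_zero_right h0, norm_neg]
    refine (norm_sum_le _ _).trans (le_of_eq ?_)
    simp
  have hd0 : d ≠ 0 := by
    intro hd0
    have h2 : c ≤ ‖eval z (Q.coeff d)‖ := hzR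
    rw [hd0] at h1 h2
    simp at h1
    rw [h1] at h2
    simp at h2
    linarith
  obtain ⟨e, he⟩ := Nat.exists_eq_succ_of_ne_zero hd0
  have h2 : ∑ j ∈ Finset.range d, ‖eval z (Q.coeff j)‖ * ‖F z‖ ^ j ≤ (S * ‖z‖ ^ N) * ‖F z‖ ^ e := by
    rw [Finset.sum_mul, Finset.sum_mul]
    refine Finset.sum_le_sum fun j hj => ?_
    gcongr
    · exact mul_nonneg (hK0 _) (by positivity)
    · exact hK _ z hz1 _ (Finset.single_le_sum (f := fun j => (Q.coeff j).natDegree) 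
        (fun _ _ => Nat.zero_le _) hj)
    · simp at hj; omega
  have h3 : c * ‖F z‖ * ‖F z‖ ^ e ≤ (S * ‖z‖ ^ N) * ‖F z‖ ^ e := by
    refine le_trans ?_ (h1.trans h2)
    rw [he, pow_succ, mul_assoc, mul_comm (‖F z‖)]
    gcongr
    rw [← he]; exact hzR
  have h4 := le_of_mul_le_mul_right h3 (by positivity)
  have h5 : ‖F z‖ ≤ S / c * ‖z‖ ^ N := by
    rw [div_mul_eq_mul_div, le_div_iff₀ hc]; linarith
  nlinarith

lemma mq_conv (P : MvPolynomial (Fin 2) ℂ) (hP : P ≠ 0) : ∃ Q : ℂ[X][X], Q ≠ 0 ∧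
    ∀ z w : ℂ, (Q.eval (C w)).eval z = MvPolynomial.eval ![z, w] P := by
  let φ : MvPolynomial (Fin 2) ℂ →+* ℂ[X][X] := MvPolynomial.eval₂Hom (C.comp C) ![C X, X]
  let ψ : ℂ[X][X] →+* MvPolynomial (Fin 2) ℂ :=
    eval₂RingHom (eval₂RingHom MvPolynomial.C (MvPolynomial.X 0)) (MvPolynomial.X 1)
  have hψ : ψ.comp φ = RingHom.id _ := by
    apply MvPolynomial.ringHom_ext
    · intro r; simp [φ, ψ]
    · intro i; fin_cases i <;> simp [φ, ψ]
  refine ⟨φ P, fun h => hP ?_, fun z w => ?_⟩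
  · have := congrArg ψ h
    rw [← RingHom.comp_apply, hψ] at this
    simpa using this
  · have : ((evalRingHom z).comp ((evalRingHom (C w)).comp φ)) = MvPolynomial.eval ![z, w] := by
      apply MvPolynomial.ringHom_ext
      · intro r; simp [φ]
      · intro i; fin_cases i <;> simp [φ]
    simpa using congrArg (fun g => g P) this

lemma mq_seq (M : ℕ → ℚ[X]) (hM : ∀ k, M k ≠ 0) : ∃ f g : ℕ → ℚ[X],
    (∀ k, f (k + 1) = f k + g k) ∧ (0 < (f 0).natDegree) ∧
    (∀ k, (f k).natDegree < (f (k + 1)).natDegree) ∧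
    (∀ k, X ^ ((f k).natDegree + 1) ∣ g k) ∧ (∀ k, M k ∣ g k) ∧
    (∀ k : ℕ, ∀ z : ℂ, ‖z‖ ≤ k → ‖aeval z (g k)‖ ≤ (1 / 4) * (1 / 2) ^ k) ∧
    (∀ k : ℕ, ∀ z : ℂ, ‖z‖ ≤ k → ∀ α : ℂ, aeval α (M k) = 0 →
      ‖aeval z (g k)‖ ≤ ((1 / 4) * (1 / 2) ^ k) * ‖aeval z (f k) - α‖) := by
  have st : ∀ (k : ℕ) (f : {f : ℚ[X] // 0 < f.natDegree}), _ := fun k f =>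
    mq_step (M k) f.1 (hM k) f.2 k ((1 / 4) * (1 / 2) ^ k) (by positivity)
  choose G h1 h2 h3 h4 h5 using st
  let f : ℕ → {f : ℚ[X] // 0 < f.natDegree} := fun n => Nat.rec ⟨X, by simp⟩
    (fun k p => ⟨p.1 + G k p, (Nat.zero_le _).trans_lt (h1 k p)⟩) n
  exact ⟨fun k => (f k).1, fun k => G k (f k), fun k => rfl, (f 0).2, fun k => h1 k (f k),
    fun k => h2 k (f k), fun k => h3 k (f k), fun k => h4 k (f k), fun k => h5 k (f k)⟩

lemma mq_iter (p : ℚ[X]) (n : ℕ) : iteratedDeriv n (fun z : ℂ => aeval z p) =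
    fun z : ℂ => aeval z (derivative^[n] p) := by
  induction n with
  | zero => simp
  | succ n ih =>
    rw [iteratedDeriv_succ, ih, Function.iterate_succ_apply']
    funext z
    exact (derivative^[n] p).deriv_aeval

lemma mq_iter0 (p : ℚ[X]) (n : ℕ) : iteratedDeriv n (fun z : ℂ => aeval z p) 0 =
    (n.factorial : ℂ) * (p.coeff n : ℂ) := by
  rw [mq_iter]
  simp only [← coeff_zero_eq_aeval_zero', coeff_iterate_derivative]
  simp [Nat.descFactorial_self]

open Filter Topology in
lemma mq_limit (p : ℕ → ℚ[X]) (F : ℂ → ℂ)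
    (h : TendstoLocallyUniformlyOn (fun k (z : ℂ) => aeval z (p k)) F atTop Set.univ) (n : ℕ) :
    Tendsto (fun k => (n.factorial : ℂ) * ((p k).coeff n : ℂ)) atTop (𝓝 (iteratedDeriv n F 0)) := by
  have key : TendstoLocallyUniformlyOn (fun k => iteratedDeriv n (fun (z : ℂ) => aeval z (p k)))
      (iteratedDeriv n F) atTop Set.univ := by
    induction n with
    | zero => simpa using h
    | succ n ih =>
      simp only [iteratedDeriv_succ]
      refine ih.deriv (Eventually.of_forall fun k => ?_) isOpen_univ
      simp only [mq_iter]
      exact (derivative^[n] (p k)).differentiable_aeval.differentiableOn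
  have := key.tendsto_at (Set.mem_univ (0:ℂ))
  simpa only [mq_iter0] using this

open Filter Topology in
lemma mq_cauchy (F : ℂ → ℂ) (hF : Differentiable ℂ F) (C : ℝ) (N : ℕ) (R : ℝ)
    (hb : ∀ z, R ≤ ‖z‖ → ‖F z‖ ≤ C * ‖z‖ ^ N) (n : ℕ) (hn : N < n) : iteratedDeriv n F 0 = 0 := by
  have h1 : ∀ᶠ r : ℝ in atTop, ‖iteratedDeriv n F 0‖ ≤ (n.factorial * C) * (r ^ N / r ^ n) := by
    filter_upwards [eventually_ge_atTop R, eventually_gt_atTop 0] with r hr hr0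
    have := Complex.norm_iteratedDeriv_le_of_forall_mem_sphere_norm_le (c := 0) (R := r)
      (C := C * r ^ N) n hr0 hF.diffContOnCl (fun z hz => by
        have hz' : ‖z‖ = r := by simpa using hz
        have := hb z (by rw [hz']; exact hr)
        rwa [hz'] at this)
    refine this.trans (le_of_eq ?_)
    ring
  have h2 : Tendsto (fun r : ℝ => (n.factorial * C) * (r ^ N / r ^ n)) atTop (𝓝 0) := by
    simpa using (tendsto_pow_div_pow_atTop_zero (𝕜 := ℝ) hn).const_mul (n.factorial * C)
  have h3 := ge_of_tendsto h2 h1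
  exact norm_le_zero_iff.1 h3

open Filter Topology in
/-- There exists a transcendental entire function `f : ℂ → ℂ` given everywhere
by a power series with rational coefficients, such that `f(Q̄) ⊆ Q̄` and `f⁻¹(Q̄) ⊆ Q̄`. -/
theorem mahler_question_exists :
    ∃ f : ℂ → ℂ,
      Differentiable ℂ f ∧
      (∀ P : MvPolynomial (Fin 2) ℂ,
        (∀ z : ℂ, MvPolynomial.eval ![z, f z] P = 0) → P = 0) ∧
      (∃ a : ℕ → ℚ, ∀ z : ℂ, HasSum (fun n : ℕ => (a n : ℂ) * z ^ n) (f z)) ∧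
      (∀ z : ℂ, IsAlgebraic ℚ z → IsAlgebraic ℚ (f z)) ∧
      (∀ z : ℂ, IsAlgebraic ℚ (f z) → IsAlgebraic ℚ z) := by
  have hcount : Countable ℚ[X] := by
    rw [← Cardinal.mk_le_aleph0_iff]
    refine Polynomial.cardinalMk_le_max.trans (by simp)
  have : Nonempty {p : ℚ[X] // p ≠ 0} := ⟨⟨X, X_ne_zero⟩⟩
  obtain ⟨m, hm⟩ := exists_surjective_nat {p : ℚ[X] // p ≠ 0}
  let M : ℕ → ℚ[X] := fun k => ∏ i ∈ Finset.range (k + 1), (m i).1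
  have hM : ∀ k, M k ≠ 0 := fun k => Finset.prod_ne_zero_iff.2 fun i _ => (m i).2
  have hroot : ∀ i k, i ≤ k → ∀ α : ℂ, aeval α (m i).1 = 0 → aeval α (M k) = 0 := by
    intro i k hik α hα
    have : (m i).1 ∣ M k := Finset.dvd_prod_of_mem (fun i => (m i).1) (by simp; omega)
    exact aeval_eq_zero_of_dvd_aeval_eq_zero this hα
  have henum : ∀ α : ℂ, IsAlgebraic ℚ α → ∃ i, aeval α (m i).1 = 0 := by
    rintro α ⟨p, hp, hpα⟩
    obtain ⟨i, hi⟩ := hm ⟨p, hp⟩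
    exact ⟨i, by rw [hi]; exact hpα⟩
  obtain ⟨f, g, hfg, hd0, hd, hX, hMg, hb1, hb2⟩ := mq_seq M hM
  have hmono : StrictMono (fun k => (f k).natDegree) := strictMono_nat_of_lt_succ hd
  have hdeg : ∀ k, k < (f k).natDegree := by
    intro k
    induction k with
    | zero => exact hd0
    | succ k ih => have := hd k; omega
  -- the limit function
  let F : ℂ → ℂ := fun z => aeval z (f 0) + ∑' k, aeval z (g k)
  have hsum : ∀ n (z : ℂ), aeval z (f n) = aeval z (f 0) + ∑ k ∈ Finset.range n, aeval z (g k) := by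
    intro n z
    induction n with
    | zero => simp
    | succ n ih => rw [hfg, map_add, ih, Finset.sum_range_succ, add_assoc]
  have hu : Summable (fun k : ℕ => (1 / 4 : ℝ) * (1 / 2) ^ k) :=
    (summable_geometric_of_lt_one (by norm_num) (by norm_num)).mul_left _
  have hloc : TendstoLocallyUniformlyOn (fun k (z : ℂ) => aeval z (f k)) F atTop Set.univ := by
    rw [tendstoLocallyUniformlyOn_iff_forall_isCompact isOpen_univ]
    intro K _ hK
    obtain ⟨R, hR⟩ := hK.isBounded.exists_norm_le
    have h1 := tendstoUniformlyOn_tsum_nat_eventually (f := fun k (z : ℂ) => aeval z (g k))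
      hu (s := K) (by
        filter_upwards [eventually_ge_atTop ⌈R⌉₊] with k hk z hz
        exact hb1 k z ((hR z hz).trans (Nat.ceil_le.1 hk)))
    rw [Metric.tendstoUniformlyOn_iff] at h1 ⊢
    intro ε hε
    filter_upwards [h1 ε hε] with k hk z hz
    have := hk z hz
    rw [hsum k z]
    simpa [F] using this
  have hFd : Differentiable ℂ F := by
    rw [← differentiableOn_univ]
    exact hloc.differentiableOn (Eventually.of_forall fun k =>
      (f k).differentiable_aeval.differentiableOn) isOpen_univ
  have hpt : ∀ z, Tendsto (fun k => aeval z (f k)) atTop (𝓝 (F z)) :=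
    fun z => hloc.tendsto_at (Set.mem_univ z)
  -- coefficients
  have hcoeff : ∀ n k, n ≤ (f k).natDegree → ∀ j, k ≤ j → (f j).coeff n = (f k).coeff n := by
    intro n k hn j hj
    induction j, hj using Nat.le_induction with
    | base => rfl
    | succ j hj ih =>
      rw [hfg, coeff_add, ih, (X_pow_dvd_iff.1 (hX j)) n, add_zero]
      have := hmono.monotone hj
      omega
  have hder : ∀ n k, n ≤ (f k).natDegree → iteratedDeriv n F 0 =
      (n.factorial : ℂ) * ((f k).coeff n : ℂ) := by
    intro n k hn
    refine tendsto_nhds_unique (mq_limit f F hloc n) ?_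
    refine tendsto_const_nhds.congr' ?_
    filter_upwards [eventually_ge_atTop k] with j hj
    rw [hcoeff n k hn j hj]
  refine ⟨F, hFd, ?_, ?_, ?_, ?_⟩
  · intro P hP
    by_contra hP0
    obtain ⟨Q, hQ, hQe⟩ := mq_conv P hP0
    obtain ⟨C, -, N, R, hb⟩ := mq_growth Q hQ F (fun z => by rw [hQe, hP])
    have h1 := mq_cauchy F hFd C N R hb _ (hdeg N)
    rw [hder _ N le_rfl] at h1
    have h2 : (f N).leadingCoeff ≠ 0 := by
      rw [leadingCoeff_ne_zero]
      intro h
      have := hdeg N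
      rw [h] at this
      simp at this
    rcases mul_eq_zero.1 h1 with h1 | h1
    · exact Nat.factorial_ne_zero _ (by exact_mod_cast h1)
    · exact h2 (by exact_mod_cast h1)
  · refine ⟨fun n => (f n).coeff n, fun z => ?_⟩
    have := Complex.hasSum_taylorSeries_of_entire hFd 0 z
    refine (congrArg (fun u : ℕ → ℂ => HasSum u (F z)) ?_).mpr this
    funext n
    rw [hder n n (hdeg n).le]
    have : (n.factorial : ℂ) ≠ 0 := by exact_mod_cast n.factorial_ne_zero
    simp only [smul_eq_mul, sub_zero]
    field_simp
  · intro α hα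
    obtain ⟨i, hi⟩ := henum α hα
    have hconst : ∀ k, i ≤ k → aeval α (f k) = aeval α (f i) := by
      intro k hk
      induction k, hk using Nat.le_induction with
      | base => rfl
      | succ k hk ih =>
        rw [hfg, map_add, ih, aeval_eq_zero_of_dvd_aeval_eq_zero (hMg k) (hroot i k hk α hi),
          add_zero]
    have : F α = aeval α (f i) := by
      refine tendsto_nhds_unique (hpt α) (tendsto_const_nhds.congr' ?_)
      filter_upwards [eventually_ge_atTop i] with k hk
      exact (hconst k hk).symm
    rw [this]
    exact isAlgebraic_iff_isIntegral.2 (by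
      have hI := isAlgebraic_iff_isIntegral.1 hα
      exact (Algebra.adjoin_le (S := integralClosure ℚ ℂ) (Set.singleton_subset_iff.2 hI))
        (Polynomial.aeval_mem_adjoin_singleton ℚ α))
  · intro z hz
    obtain ⟨i, hi⟩ := henum _ hz
    set n := max i ⌈‖z‖⌉₊ with hn
    have hzn : ‖z‖ ≤ n := (Nat.le_ceil _).trans (by exact_mod_cast le_max_right _ _)
    by_cases h0 : aeval z (f n) = F z
    · refine ⟨(m i).1.comp (f n), ?_, by rw [aeval_comp, h0, hi]⟩
      intro h
      rcases comp_eq_zero_iff.1 h with h | ⟨_, h⟩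
      · exact (m i).2 h
      · have := hdeg n
        rw [h] at this
        simp at this
    · exfalso
      set c := ‖aeval z (f n) - F z‖ with hc
      have hc0 : 0 < c := norm_pos_iff.2 (sub_ne_zero.2 h0)
      have hinv : ∀ k, n ≤ k → c / 2 * (1 + (1 / 2) ^ k) ≤ ‖aeval z (f k) - F z‖ := by
        intro k hk
        induction k, hk using Nat.le_induction with
        | base =>
          rw [← hc]
          have : ((1:ℝ) / 2) ^ n ≤ 1 := pow_le_one₀ (by norm_num) (by norm_num)
          nlinarith
        | succ k hk ih =>
          have e1 := hb2 k z (hzn.trans (by exact_mod_cast hk)) (F z)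
            (hroot i k ((le_max_left _ _).trans hk) _ hi)
          have e2 : ‖aeval z (f k) - F z‖ - ‖aeval z (g k)‖ ≤ ‖aeval z (f (k + 1)) - F z‖ := by
            rw [hfg, map_add]
            have := norm_sub_norm_le (aeval z (f k) - F z) (-(aeval z (g k)))
            rw [norm_neg] at this
            refine this.trans (le_of_eq ?_)
            congr 1; ring
          have hx1 : ((1:ℝ) / 2) ^ k ≤ 1 := pow_le_one₀ (by norm_num) (by norm_num)
          have hx0 : 0 < ((1:ℝ) / 2) ^ k := by positivity
          rw [pow_succ]
          generalize ((1:ℝ) / 2) ^ k = x at *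
          generalize ‖aeval z (f k) - F z‖ = y at *
          have e3 : (1 - 1 / 4 * x) * (c / 2 * (1 + x)) ≤ (1 - 1 / 4 * x) * y :=
            mul_le_mul_of_nonneg_left ih (by linarith)
          have e4 : 0 ≤ c * (x * (1 - x)) := by
            have := sub_nonneg.2 hx1
            positivity
          nlinarith
      have hlim : Tendsto (fun k => ‖aeval z (f k) - F z‖) atTop (𝓝 0) := by
        have := ((hpt z).sub_const (F z)).norm
        simpa using this
      have : c / 2 ≤ 0 := by
        refine ge_of_tendsto hlim ?_
        filter_upwards [eventually_ge_atTop n] with k hk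
        refine le_trans ?_ (hinv k hk)
        have : 0 ≤ ((1:ℝ) / 2) ^ k := by positivity
        nlinarith
      linarith
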